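/- Let Y be a (not necessarily complete) metric space with a geodesic structure σ such that the map (x, y, t) ↦ σ x y t is continuous on Y × Y × [0,1]. Fix p ∈ Y and suppose that every q ∈ Y has an open neighborhood U with: (1) there exists ε > 0 such that for every x ∈ U with x ≠ p there exists z ∈ Y with dist p z = dist p x + ε and σ p z (dist p x / (dist p x + ε)) = x; (2) for all x, y ∈ U and all t ∈ [0,1], if σ p x t ∈ U and σ p y t ∈ U then dist (σ p x t) (σ p y t) ≥ t·dist x y. Then for all x, y ∈ Y and all t ∈ [0,1], dist (σ p x t) (σ p y t) ≥ t·dist x y. -/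

import Mathlib

open Metric MeasureTheory ENNReal Filter

/-- A geodesic structure on a metric space. -/
structure GeodesicStructure (X : Type*) [MetricSpace X] where
  σ : X → X → ℝ → X
  σ_zero : ∀ x y, σ x y 0 = x
  σ_one : ∀ x y, σ x y 1 = y
  dist_σ : ∀ x y, ∀ s ∈ Set.Icc (0:ℝ) 1, ∀ t ∈ Set.Icc (0:ℝ) 1,
    dist (σ x y s) (σ x y t) = |s - t| * dist x y
  σ_comp : ∀ x y, ∀ s ∈ Set.Icc (0:ℝ) 1, ∀ t ∈ Set.Icc (0:ℝ) 1,
    σ x (σ x y t) s = σ x y (s * t)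

/-- Busemann convexity of a geodesic structure. -/
def GeodesicStructure.BusemannConvex {X : Type*} [MetricSpace X]
    (G : GeodesicStructure X) : Prop :=
  ∀ p x y : X, ∀ t ∈ Set.Icc (0:ℝ) 1, dist (G.σ p x t) (G.σ p y t) ≤ t * dist x y

/-- Geodesic completeness with respect to a geodesic structure. -/
def GeodesicStructure.GeodComplete {X : Type*} [MetricSpace X]
    (G : GeodesicStructure X) : Prop :=
  ∀ x y : X, x ≠ y → ∀ R : ℝ, dist x y ≤ R →
    ∃ z : X, dist x z = R ∧ G.σ x z (dist x y / R) = y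

/-- The measure contraction property MCP(0,N) with respect to a geodesic structure. -/
def GeodesicStructure.MCPzero {X : Type*} [MetricSpace X] [MeasurableSpace X]
    (G : GeodesicStructure X) (m : Measure X) (N : ℝ) : Prop :=
  ∀ p : X, ∀ A : Set X, MeasurableSet A → ∀ t ∈ Set.Icc (0:ℝ) 1,
    ENNReal.ofReal (t ^ N) * m A ≤ m ((fun x => G.σ p x t) '' A)

namespace GeodesicStructure

lemma inv_mem_Icc {c : ℝ} (hc : 1 ≤ c) : c⁻¹ ∈ Set.Icc (0:ℝ) 1 :=
  ⟨by positivity, inv_le_one_of_one_le₀ hc⟩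

variable {Y : Type*} [MetricSpace Y] (G : GeodesicStructure Y)

/-- Busemann concavity with respect to `p` between pairs of points of `U` whose contractions
also lie in `U`. -/
def ConcaveOn (p : Y) (U : Set Y) : Prop :=
  ∀ x ∈ U, ∀ y ∈ U, ∀ t ∈ Set.Icc (0:ℝ) 1, G.σ p x t ∈ U → G.σ p y t ∈ U →
    t * dist x y ≤ dist (G.σ p x t) (G.σ p y t)

/-- Every point of `U` other than `p` lies on a geodesic from `p` extending past it by `ε`. -/
def ExtendsOn (p : Y) (U : Set Y) (ε : ℝ) : Prop :=
  ∀ x ∈ U, x ≠ p →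
    ∃ z : Y, dist p z = dist p x + ε ∧ G.σ p z (dist p x / (dist p x + ε)) = x

variable {G}

lemma ConcaveOn.mono {p : Y} {U V : Set Y} (h : G.ConcaveOn p V) (hUV : U ⊆ V) :
    G.ConcaveOn p U :=
  fun x hx y hy t ht hxt hyt => h x (hUV hx) y (hUV hy) t ht (hUV hxt) (hUV hyt)

variable (G)

lemma σ_self (p : Y) {t : ℝ} (ht : t ∈ Set.Icc (0:ℝ) 1) : G.σ p p t = p := by
  have h := G.dist_σ p p t ht 0 (by simp)
  rwa [dist_self, mul_zero, G.σ_zero, dist_eq_zero] at h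

lemma dist_left_σ (x y : Y) {t : ℝ} (ht : t ∈ Set.Icc (0:ℝ) 1) :
    dist x (G.σ x y t) = t * dist x y := by
  have h := G.dist_σ x y 0 (by simp) t ht
  rwa [G.σ_zero, zero_sub, abs_neg, abs_of_nonneg ht.1] at h

lemma dist_σ_right (x y : Y) {t : ℝ} (ht : t ∈ Set.Icc (0:ℝ) 1) :
    dist (G.σ x y t) y = (1 - t) * dist x y := by
  have h := G.dist_σ x y t ht 1 (by simp)
  rwa [G.σ_one, abs_sub_comm, abs_of_nonneg (sub_nonneg.2 ht.2)] at h

lemma continuousOn_σ (x y : Y) : ContinuousOn (G.σ x y) (Set.Icc 0 1) := by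
  have h : LipschitzOnWith (nndist x y) (G.σ x y) (Set.Icc 0 1) :=
    LipschitzOnWith.of_dist_le_mul fun s hs t ht => by
      rw [G.dist_σ x y s hs t ht, Real.dist_eq, coe_nndist, mul_comm]
  exact h.continuousOn

variable {G}

lemma dist_eq_of_σ_inv_eq {p x z : Y} {c : ℝ} (hc : 1 ≤ c) (h : G.σ p z c⁻¹ = x) :
    dist x z = (c - 1) * dist p x := by
  subst h
  rw [G.dist_σ_right p z (inv_mem_Icc hc), G.dist_left_σ p z (inv_mem_Icc hc)]
  field_simp

lemma ExtendsOn.exists_σ_inv_eq {p x : Y} {U : Set Y} {ε c : ℝ} (h : G.ExtendsOn p U ε)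
    (hε : 0 < ε) (hx : x ∈ U) (hc : 1 ≤ c) (hcε : (c - 1) * dist p x ≤ ε) :
    ∃ z, G.σ p z c⁻¹ = x := by
  rcases eq_or_ne x p with rfl | hxp
  · exact ⟨x, G.σ_self x (inv_mem_Icc hc)⟩
  obtain ⟨z, -, hz⟩ := h x hx hxp
  have hd : 0 < dist p x := dist_pos.2 hxp.symm
  refine ⟨G.σ p z (c * (dist p x / (dist p x + ε))), ?_⟩
  rw [G.σ_comp p z _ (inv_mem_Icc hc), inv_mul_cancel_left₀ (by positivity), hz]
  refine ⟨by positivity, ?_⟩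
  rw [← mul_div_assoc, div_le_one (by positivity)]
  linarith

/-- On a compact set, the local extension and concavity hypotheses hold at a uniform scale. -/
lemma exists_uniform_scale {p : Y}
    (hloc : ∀ q : Y, ∃ U : Set Y, IsOpen U ∧ q ∈ U ∧
      (∃ ε : ℝ, 0 < ε ∧ G.ExtendsOn p U ε) ∧ G.ConcaveOn p U)
    {K : Set Y} (hK : IsCompact K) :
    ∃ δ > 0, ∀ x ∈ K, (∀ c, 1 ≤ c → c ≤ 1 + δ → ∃ z, G.σ p z c⁻¹ = x) ∧
      G.ConcaveOn p (ball x δ) := by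
  refine hK.induction_on ⟨1, one_pos, by simp⟩ ?_ ?_ ?_
  · rintro s t hst ⟨δ, hδ, h⟩
    exact ⟨δ, hδ, fun x hx => h x (hst hx)⟩
  · rintro s t ⟨δ, hδ, h⟩ ⟨δ', hδ', h'⟩
    refine ⟨min δ δ', lt_min hδ hδ', ?_⟩
    rintro x (hx | hx)
    · exact ⟨fun c hc hcδ => (h x hx).1 c hc (hcδ.trans (by gcongr; exact min_le_left _ _)),
        (h x hx).2.mono (ball_subset_ball (min_le_left _ _))⟩
    · exact ⟨fun c hc hcδ => (h' x hx).1 c hc (hcδ.trans (by gcongr; exact min_le_right _ _)),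
        (h' x hx).2.mono (ball_subset_ball (min_le_right _ _))⟩
  · intro q _
    obtain ⟨U, hU, hqU, ⟨ε, hε, hext⟩, hconc⟩ := hloc q
    obtain ⟨r, hr, hrU⟩ := Metric.isOpen_iff.1 hU q hqU
    have hD : 0 < dist p q + r := by positivity
    refine ⟨ball q (r / 2), mem_nhdsWithin_of_mem_nhds (ball_mem_nhds q (half_pos hr)),
      min (r / 2) (ε / (dist p q + r)), lt_min (half_pos hr) (by positivity), fun x hx => ?_⟩
    rw [mem_ball] at hx
    refine ⟨fun c hc hcδ => hext.exists_σ_inv_eq hε (hrU (by rw [mem_ball]; linarith)) hc ?_,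
      hconc.mono ((ball_subset_ball' ?_).trans hrU)⟩
    · have h₁ : c - 1 ≤ ε / (dist p q + r) := by
        linarith [min_le_right (r / 2) (ε / (dist p q + r))]
      have h₂ : dist p x ≤ dist p q + r := by
        linarith [dist_triangle_right p x q, dist_comm q x]
      calc (c - 1) * dist p x ≤ ε / (dist p q + r) * (dist p q + r) := by gcongr
        _ = ε := div_mul_cancel₀ _ hD.ne'
    · linarith [min_le_left (r / 2) (ε / (dist p q + r))]

/-- Dilations from `p` by a factor `c` close to `1` expand the distance of two given points by at
most `c`: subdivide the geodesic joining the points and dilate each short piece. -/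
lemma exists_dist_le_mul_of_σ_inv_eq {p : Y}
    (hloc : ∀ q : Y, ∃ U : Set Y, IsOpen U ∧ q ∈ U ∧
      (∃ ε : ℝ, 0 < ε ∧ G.ExtendsOn p U ε) ∧ G.ConcaveOn p U) (a b : Y) :
    ∃ δ > 0, ∀ c, 1 ≤ c → c ≤ 1 + δ → ∀ a' b', G.σ p a' c⁻¹ = a → G.σ p b' c⁻¹ = b →
      dist a' b' ≤ c * dist a b := by
  obtain ⟨δ, hδ, hK⟩ := exists_uniform_scale hloc
    (isCompact_Icc.image_of_continuousOn (G.continuousOn_σ a b))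
  rw [Set.forall_mem_image] at hK
  set D := dist p a + dist a b + 1
  have hDpos : 0 < D := by positivity
  refine ⟨min δ (δ / 2 / D), by positivity, fun c hc hcδ a' b' ha' hb' => ?_⟩
  obtain ⟨n, hn⟩ := exists_nat_gt (dist a b / (δ / 2))
  have hn₀ : (0:ℝ) < n := lt_of_le_of_lt (by positivity) hn
  have hstep : dist a b / n < δ / 2 := by
    rwa [div_lt_iff₀ hn₀, ← div_lt_iff₀' (half_pos hδ)]
  set u : ℕ → ℝ := fun i => i / n with hu
  have hu_mem : ∀ i ≤ n, u i ∈ Set.Icc (0:ℝ) 1 := fun i hi =>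
    ⟨by positivity, (div_le_one hn₀).2 (by exact_mod_cast hi)⟩
  have hlift : ∀ i, ∃ z, i ≤ n → G.σ p z c⁻¹ = G.σ a b (u i) ∧ (i = 0 → z = a') ∧
      (i = n → z = b') := by
    intro i
    by_cases hi : i ≤ n
    · have hn₁ : n ≠ 0 := by exact_mod_cast hn₀.ne'
      rcases eq_or_ne i 0 with rfl | hi₀
      · exact ⟨a', fun _ => ⟨by simp [hu, G.σ_zero, ha'], fun _ => rfl, fun h => absurd h.symm hn₁⟩⟩
      rcases eq_or_ne i n with rfl | hi₁
      · exact ⟨b', fun _ => ⟨by simp [hu, hn₁, G.σ_one, hb'], fun h => absurd h hi₀, fun _ => rfl⟩⟩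
      obtain ⟨z, hz⟩ := (hK (hu_mem i hi)).1 c hc (hcδ.trans (by gcongr; exact min_le_left _ _))
      exact ⟨z, fun _ => ⟨hz, fun h => absurd h hi₀, fun h => absurd h hi₁⟩⟩
    · exact ⟨a', fun h => absurd h hi⟩
  choose z hz using hlift
  have hz_near : ∀ i ≤ n, dist (G.σ a b (u i)) (z i) < δ / 2 := by
    intro i hi
    rw [dist_eq_of_σ_inv_eq hc (hz i hi).1]
    have h₁ : dist p (G.σ a b (u i)) < D := by
      have h₂ := G.dist_left_σ a b (hu_mem i hi)
      have h₃ := mul_le_of_le_one_left (dist_nonneg (x := a) (y := b)) (hu_mem i hi).2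
      linarith [dist_triangle p a (G.σ a b (u i))]
    have h₂ : c - 1 ≤ δ / 2 / D := by linarith [min_le_right δ (δ / 2 / D)]
    calc (c - 1) * dist p (G.σ a b (u i)) ≤ δ / 2 / D * dist p (G.σ a b (u i)) := by gcongr
      _ < δ / 2 / D * D := by gcongr
      _ = δ / 2 := div_mul_cancel₀ _ hDpos.ne'
  have hz_step : ∀ {i}, i < n → dist (z i) (z (i + 1)) ≤ c * (dist a b / n) := by
    intro i hi
    have hη : dist (G.σ a b (u i)) (G.σ a b (u (i + 1))) = dist a b / n := by
      rw [G.dist_σ a b _ (hu_mem i hi.le) _ (hu_mem (i + 1) hi), abs_sub_comm]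
      have : u (i + 1) - u i = (n:ℝ)⁻¹ := by simp only [hu]; push_cast; ring
      rw [this, abs_of_pos (inv_pos.2 hn₀), div_eq_inv_mul]
    have h₁ := hz_near i hi.le
    have h₂ := hz_near (i + 1) hi
    have h := (hK (hu_mem i hi.le)).2 (z i) ?_ (z (i + 1)) ?_ c⁻¹ (inv_mem_Icc hc) ?_ ?_
    · rw [(hz i hi.le).1, (hz (i + 1) hi).1, hη] at h
      rwa [← inv_mul_le_iff₀ (by positivity)]
    · rw [mem_ball']; linarith
    · rw [mem_ball']
      linarith [dist_triangle (G.σ a b (u i)) (G.σ a b (u (i + 1))) (z (i + 1))]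
    · rw [(hz i hi.le).1]; exact mem_ball_self hδ
    · rw [(hz (i + 1) hi).1, mem_ball']; linarith
  have h := dist_le_range_sum_of_dist_le n hz_step
  rw [(hz 0 n.zero_le).2.1 rfl, (hz n le_rfl).2.2 rfl, Finset.sum_const, Finset.card_range,
    nsmul_eq_mul] at h
  calc dist a' b' ≤ n * (c * (dist a b / n)) := h
    _ = c * dist a b := by field_simp

end GeodesicStructure

theorem busemann_concavity_globalization
    (Y : Type*) [MetricSpace Y] (G : GeodesicStructure Y)
    (hcont : ContinuousOn (fun q : Y × Y × ℝ => G.σ q.1 q.2.1 q.2.2)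
      {q : Y × Y × ℝ | q.2.2 ∈ Set.Icc (0:ℝ) 1})
    (p : Y)
    (hloc : ∀ q : Y, ∃ U : Set Y, IsOpen U ∧ q ∈ U ∧
      (∃ ε : ℝ, 0 < ε ∧ ∀ x ∈ U, x ≠ p →
        ∃ z : Y, dist p z = dist p x + ε ∧ G.σ p z (dist p x / (dist p x + ε)) = x) ∧
      (∀ x ∈ U, ∀ y ∈ U, ∀ t ∈ Set.Icc (0:ℝ) 1,
        G.σ p x t ∈ U → G.σ p y t ∈ U →
          t * dist x y ≤ dist (G.σ p x t) (G.σ p y t))) :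
    ∀ x y : Y, ∀ t ∈ Set.Icc (0:ℝ) 1,
      t * dist x y ≤ dist (G.σ p x t) (G.σ p y t) := by
  intro x y t ht
  rcases ht.1.eq_or_lt with rfl | ht₀
  · rw [zero_mul]; exact dist_nonneg
  set f : ℝ → ℝ := fun s => dist (G.σ p x s) (G.σ p y s) with hf
  have hfc : ContinuousOn f (Set.Icc t 1) :=
    (continuous_dist.comp_continuousOn
      ((G.continuousOn_σ p x).prodMk (G.continuousOn_σ p y))).mono (Set.Icc_subset_Icc_left ht.1)
  have hsub : Set.Icc t 1 ⊆ {s | t * f s ≤ s * f t} := by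
    refine IsClosed.Icc_subset_of_forall_exists_gt ?_ (le_refl (t * f t)) ?_
    · rw [Set.inter_comm]
      exact isClosed_Icc.isClosed_le (continuousOn_const.mul hfc)
        (continuousOn_id.mul continuousOn_const)
    · rintro s ⟨hs, hts, hs₁⟩ s' (hss' : s < s')
      have hs₀ : 0 < s := ht₀.trans_le hts
      obtain ⟨δ, hδ, h⟩ := GeodesicStructure.exists_dist_le_mul_of_σ_inv_eq hloc
        (G.σ p x s) (G.σ p y s)
      set r := min (min s' 1) ((1 + δ) * s)
      have hsr : s < r := lt_min (lt_min hss' hs₁) (by nlinarith)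
      have hr₀ : 0 < r := hs₀.trans hsr
      have hr₁ : r ≤ 1 := (min_le_left _ _).trans (min_le_right _ _)
      have hc : 1 ≤ r / s := (one_le_div hs₀).2 hsr.le
      have hcontract : ∀ w, G.σ p (G.σ p w r) (r / s)⁻¹ = G.σ p w s := fun w => by
        rw [G.σ_comp p w _ (GeodesicStructure.inv_mem_Icc hc) r ⟨hr₀.le, hr₁⟩, inv_div,
          div_mul_cancel₀ _ hr₀.ne']
      have hle : f r ≤ r / s * f s := h (r / s) hc ((div_le_iff₀ hs₀).2 (min_le_right _ _)) _ _
        (hcontract x) (hcontract y)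
      refine ⟨r, ?_, hsr, (min_le_left _ _).trans (min_le_left _ _)⟩
      calc t * f r ≤ t * (r / s * f s) := by gcongr
        _ = r / s * (t * f s) := by ring
        _ ≤ r / s * (s * f t) := mul_le_mul_of_nonneg_left hs (by positivity)
        _ = r * f t := by field_simp
  have h : t * f 1 ≤ 1 * f t := hsub ⟨ht.2, le_rfl⟩
  simpa only [hf, G.σ_one, one_mul] using h
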